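/- Let R : {1,2,3}⁴ → ℝ be an algebraic curvature tensor on ℝ³, i.e. R_{ijkl} = −R_{jikl} = −R_{ijlk} = R_{klij} for all indices, with Ric_{jl} = Σ_i R_{jiil}, Scal = Σ_j Ric_{jj}, and Einstein tensor E_{ij} = Ric_{ij} − ½ Scal δ_{ij}. Then the two expressions for the cross curvature tensor agree: for all i, j ∈ {1,2,3}, (1/8) Σ_{p,q,k,r,s,l} ε(p,q,k) ε(r,s,l) R_{ilpq} R_{kjrs} = (1/2) Σ_{p,q,r,s} ε(i,p,q) ε(j,r,s) E_{pr} E_{qs}. -/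

import Mathlib

/-- The Levi-Civita symbol on `{1,2,3}` (indices modelled by `Fin 3`):
`levCivita i j k` is the sign of the permutation `(i,j,k)` when the indices are
pairwise distinct, and `0` otherwise. -/
noncomputable def levCivita (i j k : Fin 3) : ℝ :=
  Matrix.det (Matrix.of ![Pi.single i (1 : ℝ), Pi.single j 1, Pi.single k 1])

/-- The Kronecker delta on `{1,2,3}`. -/
def kdelta (i j : Fin 3) : ℝ := if i = j then 1 else 0

theorem lc_sum (f : Fin 3 → Fin 3 → Fin 3 → ℝ) :
    ∑ p, ∑ q, ∑ k, levCivita p q k * f p q k =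
      f 0 1 2 + f 1 2 0 + f 2 0 1 - f 0 2 1 - f 2 1 0 - f 1 0 2 := by
  simp [Fin.sum_univ_three, levCivita, Matrix.det_fin_three, Pi.single_apply]
  ring

theorem lc_sum0 (f : Fin 3 → Fin 3 → ℝ) :
    ∑ p, ∑ q, levCivita 0 p q * f p q = f 1 2 - f 2 1 := by
  simp [Fin.sum_univ_three, levCivita, Matrix.det_fin_three, Pi.single_apply]
  ring

theorem lc_sum1 (f : Fin 3 → Fin 3 → ℝ) :
    ∑ p, ∑ q, levCivita 1 p q * f p q = f 2 0 - f 0 2 := by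
  simp [Fin.sum_univ_three, levCivita, Matrix.det_fin_three, Pi.single_apply]
  ring

theorem lc_sum2 (f : Fin 3 → Fin 3 → ℝ) :
    ∑ p, ∑ q, levCivita 2 p q * f p q = f 0 1 - f 1 0 := by
  simp [Fin.sum_univ_three, levCivita, Matrix.det_fin_three, Pi.single_apply]
  ring

/-- For an algebraic curvature tensor `R` on `ℝ³`, with Ricci tensor
`Ric_{jl} = Σ_i R_{jiil}`, scalar curvature `Scal = Σ_j Ric_{jj}` and Einstein tensor
`E_{ij} = Ric_{ij} - ½ Scal δ_{ij}`, the two expressions for the cross curvature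
tensor agree: for all `i j`,
`(1/8) Σ_{p,q,k,r,s,l} ε(p,q,k) ε(r,s,l) R_{ilpq} R_{kjrs}
  = (1/2) Σ_{p,q,r,s} ε(i,p,q) ε(j,r,s) E_{pr} E_{qs}`. -/
theorem crossCurvature_expressions_agree
    (R : Fin 3 → Fin 3 → Fin 3 → Fin 3 → ℝ)
    (hskew₁ : ∀ i j k l, R i j k l = - R j i k l)
    (hskew₂ : ∀ i j k l, R i j k l = - R i j l k)
    (hpair : ∀ i j k l, R i j k l = R k l i j)
    (Ric : Fin 3 → Fin 3 → ℝ) (hRic : ∀ j l, Ric j l = ∑ i, R j i i l)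
    (Scal : ℝ) (hScal : Scal = ∑ j, Ric j j)
    (Ein : Fin 3 → Fin 3 → ℝ)
    (hEin : ∀ i j, Ein i j = Ric i j - (1 / 2 : ℝ) * Scal * kdelta i j)
    (i j : Fin 3) :
    (1 / 8 : ℝ) * ∑ p, ∑ q, ∑ k, ∑ r, ∑ s, ∑ l,
        levCivita p q k * levCivita r s l * R i l p q * R k j r s
      = (1 / 2 : ℝ) * ∑ p, ∑ q, ∑ r, ∑ s,
        levCivita i p q * levCivita j r s * Ein p r * Ein q s := by
  have z1 : ∀ a k l, R a a k l = 0 := fun a k l => by linarith [hskew₁ a a k l]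
  have z2 : ∀ a k l, R k l a a = 0 := fun a k l => by linarith [hskew₂ k l a a]
  have a1 : ∀ k l, R 1 0 k l = - R 0 1 k l := fun k l => hskew₁ _ _ _ _
  have a2 : ∀ k l, R 2 0 k l = - R 0 2 k l := fun k l => hskew₁ _ _ _ _
  have a3 : ∀ k l, R 2 1 k l = - R 1 2 k l := fun k l => hskew₁ _ _ _ _
  have b1 : ∀ k l, R k l 1 0 = - R k l 0 1 := fun k l => hskew₂ _ _ _ _
  have b2 : ∀ k l, R k l 2 0 = - R k l 0 2 := fun k l => hskew₂ _ _ _ _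
  have b3 : ∀ k l, R k l 2 1 = - R k l 1 2 := fun k l => hskew₂ _ _ _ _
  have c1 : R 0 2 0 1 = R 0 1 0 2 := hpair _ _ _ _
  have c2 : R 1 2 0 1 = R 0 1 1 2 := hpair _ _ _ _
  have c3 : R 1 2 0 2 = R 0 2 1 2 := hpair _ _ _ _
  have L : ∑ p, ∑ q, ∑ k, ∑ r, ∑ s, ∑ l,
        levCivita p q k * levCivita r s l * R i l p q * R k j r s
      = ∑ p, ∑ q, ∑ k, levCivita p q k *
          ∑ r, ∑ s, ∑ l, levCivita r s l * (R i l p q * R k j r s) := by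
    simp only [Finset.mul_sum, mul_assoc]
  have L' : ∑ p, ∑ q, ∑ r, ∑ s,
        levCivita i p q * levCivita j r s * Ein p r * Ein q s
      = ∑ p, ∑ q, levCivita i p q *
          ∑ r, ∑ s, levCivita j r s * (Ein p r * Ein q s) := by
    simp only [Finset.mul_sum, mul_assoc]
  rw [L, L']
  simp only [lc_sum]
  have k00 : kdelta 0 0 = 1 := by simp [kdelta]
  have k11 : kdelta 1 1 = 1 := by simp [kdelta]
  have k22 : kdelta 2 2 = 1 := by simp [kdelta]
  have k01 : kdelta 0 1 = 0 := by simp [kdelta]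
  have k02 : kdelta 0 2 = 0 := by simp [kdelta]
  have k12 : kdelta 1 2 = 0 := by simp [kdelta]
  have k10 : kdelta 1 0 = 0 := by simp [kdelta]
  have k20 : kdelta 2 0 = 0 := by simp [kdelta]
  have k21 : kdelta 2 1 = 0 := by simp [kdelta]
  fin_cases i <;> fin_cases j <;>
  · simp only [Fin.zero_eta, Fin.mk_one, Fin.reduceFinMk, lc_sum0, lc_sum1, lc_sum2]
    simp only [hEin,
      k00, k11, k22, k01, k02, k12, k10, k20, k21, hScal, hRic, Fin.sum_univ_three,
      z1, z2, a1, a2, a3, b1, b2, b3, c1, c2, c3]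
    ring
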